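/- arXiv:2409.18112 — 6 statements merged into one kernel-verified Lean document; each statement's English description precedes it below -/
import Mathlib

section
/- Let X be a set, Y a real normed vector space, c : X × Y → ℝ, x : [0,1] → X a path and ȳ ∈ Y. Assume that for every s ∈ [0,1] the function y ↦ c(x(s), y) is Fréchet differentiable at ȳ, and that for all s ∈ [0,1] and all y ∈ Y one has c(x(s),ȳ) − c(x(s),y) ≤ (1−s)·(c(x(0),ȳ) − c(x(0),y)) + s·(c(x(1),ȳ) − c(x(1),y)). Then for every s ∈ [0,1], the Fréchet derivative of y ↦ c(x(s),y) at ȳ equals (1−s)·D₀ + s·D₁ as continuous linear functionals on Y, where D₀ and D₁ are the Fréchet derivatives at ȳ of y ↦ c(x(0),y) and y ↦ c(x(1),y) respectively. -/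
/-- Curves satisfying the below-the-chord inequality are automatically
c-segments: the Fréchet derivative of `y ↦ c (x s) y` at `ȳ` interpolates linearly
between its values at the endpoints. -/
theorem fderiv_interpolates_of_below_chord
    {X : Type*} {Y : Type*} [NormedAddCommGroup Y] [NormedSpace ℝ Y]
    (c : X → Y → ℝ) (x : ℝ → X) (ybar : Y)
    (hdiff : ∀ s ∈ Set.Icc (0:ℝ) 1, DifferentiableAt ℝ (fun y => c (x s) y) ybar)
    (hineq : ∀ s ∈ Set.Icc (0:ℝ) 1, ∀ y : Y,
      c (x s) ybar - c (x s) y ≤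
        (1 - s) * (c (x 0) ybar - c (x 0) y) + s * (c (x 1) ybar - c (x 1) y)) :
    ∀ s ∈ Set.Icc (0:ℝ) 1,
      fderiv ℝ (fun y => c (x s) y) ybar
        = (1 - s) • fderiv ℝ (fun y => c (x 0) y) ybar
          + s • fderiv ℝ (fun y => c (x 1) y) ybar := by
  intro s hs
  have hd := (hdiff s hs).hasFDerivAt.sub
    (((hdiff 0 (by simp)).hasFDerivAt.const_smul (1 - s)).add
      ((hdiff 1 (by simp)).hasFDerivAt.const_smul s))
  refine sub_eq_zero.mp (IsLocalMin.hasFDerivAt_eq_zero (Filter.Eventually.of_forall fun y => ?_) hd)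
  simp only [Pi.sub_apply, Pi.add_apply, Pi.smul_apply, smul_eq_mul]
  linarith [hineq s hs y]
end

section
/- Let A be a finite index set and for each a ∈ A let (Xᵃ × Yᵃ, cᵃ) be an NNCC space with cost cᵃ : Xᵃ × Yᵃ → EReal never taking the value −∞. Let 𝐗 = ∏_{a∈A} Xᵃ, 𝐘 = ∏_{a∈A} Yᵃ and 𝐜(𝐱,𝐲) = ∑_{a∈A} cᵃ(xᵃ,yᵃ), a sum in EReal of terms that are never −∞. Then (𝐗 × 𝐘, 𝐜) is an NNCC space. -/
/-- A variational c-segment on a cost space `(X × Y, c)` with `c` valued in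
`EReal = [-∞, +∞]`: the cost `c (x s) ȳ` is a real number for every `s ∈ [0,1]`, and for
every `s ∈ (0,1)`, every `y` and all real upper bounds `t₀, t₁` of the extended-real
differences `c (x 0) ȳ - c (x 0) y` and `c (x 1) ȳ - c (x 1) y`, one has
`c (x s) ȳ - c (x s) y ≤ (1-s) t₀ + s t₁`. -/
def IsVarCSegment {X Y : Type*} (c : X → Y → EReal) (x : ℝ → X) (ybar : Y) : Prop :=
  (∀ s ∈ Set.Icc (0:ℝ) 1, c (x s) ybar ≠ ⊤ ∧ c (x s) ybar ≠ ⊥) ∧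
  ∀ s ∈ Set.Ioo (0:ℝ) 1, ∀ y : Y, ∀ t0 t1 : ℝ,
    c (x 0) ybar - c (x 0) y ≤ (t0 : EReal) →
    c (x 1) ybar - c (x 1) y ≤ (t1 : EReal) →
    c (x s) ybar - c (x s) y ≤ (((1 - s) * t0 + s * t1 : ℝ) : EReal)

/-- `(X × Y, c)` is an NNCC space: any two points of `X` with finite cost to a common base
point `ȳ ∈ Y` are joined by a variational c-segment. -/
def IsNNCC {X Y : Type*} (c : X → Y → EReal) : Prop :=
  ∀ x0 x1 : X, ∀ ybar : Y,
    (c x0 ybar ≠ ⊤ ∧ c x0 ybar ≠ ⊥) → (c x1 ybar ≠ ⊤ ∧ c x1 ybar ≠ ⊥) →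
    ∃ x : ℝ → X, x 0 = x0 ∧ x 1 = x1 ∧ IsVarCSegment c x ybar

namespace EReal

theorem coe_finsetSum {ι : Type*} (s : Finset ι) (f : ι → ℝ) :
    ((∑ i ∈ s, f i : ℝ) : EReal) = ∑ i ∈ s, (f i : EReal) := by
  classical
  induction s using Finset.induction_on with
  | empty => simp
  | insert i s hi ih => rw [Finset.sum_insert hi, Finset.sum_insert hi, EReal.coe_add, ih]

theorem finsetSum_ne_bot {ι : Type*} (s : Finset ι) {f : ι → EReal} (hf : ∀ i, f i ≠ ⊥) :
    ∑ i ∈ s, f i ≠ ⊥ := by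
  classical
  induction s using Finset.induction_on with
  | empty => simp
  | insert i s hi ih => rw [Finset.sum_insert hi]; exact add_ne_bot_iff.2 ⟨hf i, ih⟩

theorem finsetSum_eq_top {ι : Type*} {s : Finset ι} {f : ι → EReal} (hf : ∀ i, f i ≠ ⊥)
    {i : ι} (hi : i ∈ s) (htop : f i = ⊤) : ∑ j ∈ s, f j = ⊤ := by
  classical
  rw [← Finset.add_sum_erase s f hi, htop]
  exact top_add_of_ne_bot (finsetSum_ne_bot _ hf)

/-- A real upper bound of a difference of sums splits into real upper bounds of the
differences of the summands. -/
theorem exists_bounds_of_sum_sub_sum_le {ι : Type*} [Fintype ι] (p : ι → ℝ) {q : ι → EReal}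
    (hq : ∀ i, q i ≠ ⊥) {t : ℝ} (h : ∑ i, (p i : EReal) - ∑ i, q i ≤ t) :
    ∃ g : ι → ℝ, (∀ i, (p i : EReal) - q i ≤ g i) ∧ ∑ i, g i ≤ t := by
  classical
  by_cases htop : ∃ i, q i = ⊤
  · obtain ⟨i, hi⟩ := htop
    refine ⟨Function.update (fun j => p j - (q j).toReal) i
      (t - ∑ j ∈ Finset.univ \ {i}, (p j - (q j).toReal)), fun j => ?_, ?_⟩
    · by_cases hj : q j = ⊤
      · simp [hj]
      · have hji : j ≠ i := fun e => hj (e ▸ hi)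
        rw [Function.update_of_ne hji, EReal.coe_sub, coe_toReal hj (hq j)]
    · rw [Finset.sum_update_of_mem (Finset.mem_univ i)]
      simp
  · push Not at htop
    lift q to ι → ℝ using fun i => ⟨htop i, hq i⟩
    refine ⟨fun i => p i - q i, fun i => (EReal.coe_sub _ _).ge, ?_⟩
    rw [← coe_finsetSum, ← coe_finsetSum, ← EReal.coe_sub, EReal.coe_le_coe_iff] at h
    rwa [Finset.sum_sub_distrib]

theorem sum_sub_sum_le {ι : Type*} [Fintype ι] (p : ι → ℝ) {q : ι → EReal}
    (hq : ∀ i, q i ≠ ⊥) {r : ι → ℝ} (h : ∀ i, (p i : EReal) - q i ≤ r i) :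
    ∑ i, (p i : EReal) - ∑ i, q i ≤ (∑ i, r i : ℝ) := by
  by_cases htop : ∃ i, q i = ⊤
  · obtain ⟨i, hi⟩ := htop
    rw [finsetSum_eq_top hq (Finset.mem_univ i) hi, sub_top]
    exact bot_le
  · push Not at htop
    lift q to ι → ℝ using fun i => ⟨htop i, hq i⟩
    rw [← coe_finsetSum, ← coe_finsetSum, ← EReal.coe_sub, EReal.coe_le_coe_iff,
      ← Finset.sum_sub_distrib]
    exact Finset.sum_le_sum fun i _ =>
      EReal.coe_le_coe_iff.1 ((EReal.coe_sub _ _).trans_le (h i))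

end EReal

/-- A path whose components are variational c-segments is a variational c-segment for the
sum cost. -/
theorem IsVarCSegment.pi {A : Type*} [Fintype A] {X Y : A → Type*}
    {c : ∀ a, X a → Y a → EReal} (hne : ∀ a (xa : X a) (ya : Y a), c a xa ya ≠ ⊥)
    {x : ∀ a, ℝ → X a} {ybar : ∀ a, Y a} (hx : ∀ a, IsVarCSegment (c a) (x a) (ybar a)) :
    IsVarCSegment (fun (x : ∀ a, X a) (y : ∀ a, Y a) => ∑ a, c a (x a) (y a))
      (fun s a => x a s) ybar := by
  have hreal : ∀ s ∈ Set.Icc (0 : ℝ) 1, ∀ a,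
      ((c a (x a s) (ybar a)).toReal : EReal) = c a (x a s) (ybar a) := fun s hs a =>
    EReal.coe_toReal ((hx a).1 s hs).1 ((hx a).1 s hs).2
  have hsum : ∀ s ∈ Set.Icc (0 : ℝ) 1,
      ∑ a, c a (x a s) (ybar a) = ∑ a, ((c a (x a s) (ybar a)).toReal : EReal) := fun s hs =>
    Finset.sum_congr rfl fun a _ => (hreal s hs a).symm
  refine ⟨fun s hs => ?_, fun s hs y t0 t1 h0 h1 => ?_⟩
  · beta_reduce
    rw [hsum s hs, ← EReal.coe_finsetSum]
    exact ⟨EReal.coe_ne_top _, EReal.coe_ne_bot _⟩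
  · have m0 : (0 : ℝ) ∈ Set.Icc (0 : ℝ) 1 := by simp
    have m1 : (1 : ℝ) ∈ Set.Icc (0 : ℝ) 1 := by simp
    have ms := Set.Ioo_subset_Icc_self hs
    beta_reduce at h0 h1
    rw [hsum 0 m0] at h0
    rw [hsum 1 m1] at h1
    obtain ⟨g0, hg0, hs0⟩ := EReal.exists_bounds_of_sum_sub_sum_le _ (fun a => hne a _ _) h0
    obtain ⟨g1, hg1, hs1⟩ := EReal.exists_bounds_of_sum_sub_sum_le _ (fun a => hne a _ _) h1
    simp only [hreal 0 m0] at hg0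
    simp only [hreal 1 m1] at hg1
    have key := EReal.sum_sub_sum_le (fun a => (c a (x a s) (ybar a)).toReal)
      (q := fun a => c a (x a s) (y a)) (fun a => hne a _ _)
      (r := fun a => (1 - s) * g0 a + s * g1 a) fun a => by
        rw [hreal s ms]
        exact (hx a).2 s hs (y a) _ _ (hg0 a) (hg1 a)
    beta_reduce
    rw [hsum s ms]
    refine key.trans (EReal.coe_le_coe_iff.2 ?_)
    rw [Finset.sum_add_distrib, ← Finset.mul_sum, ← Finset.mul_sum]
    exact add_le_add (mul_le_mul_of_nonneg_left hs0 (sub_nonneg.2 ms.2))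
      (mul_le_mul_of_nonneg_left hs1 ms.1)

/-- Finite products of NNCC spaces (with costs never equal to `-∞`)
are NNCC spaces for the sum cost. -/
theorem products_preserve_NNCC
    {A : Type*} [Fintype A] {X Y : A → Type*}
    (c : ∀ a, X a → Y a → EReal)
    (hne : ∀ a (xa : X a) (ya : Y a), c a xa ya ≠ ⊥)
    (hnncc : ∀ a, IsNNCC (c a)) :
    IsNNCC (fun (x : ∀ a, X a) (y : ∀ a, Y a) => ∑ a, c a (x a) (y a)) := by
  intro x0 x1 ybar h0 h1
  have real : ∀ z : ∀ a, X a, ∑ a, c a (z a) (ybar a) ≠ ⊤ →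
      ∀ a, c a (z a) (ybar a) ≠ ⊤ ∧ c a (z a) (ybar a) ≠ ⊥ := fun z hz a =>
    ⟨fun ha => hz (EReal.finsetSum_eq_top (fun a => hne a _ _) (Finset.mem_univ a) ha),
      hne a _ _⟩
  choose x hx0 hx1 hx using fun a =>
    hnncc a (x0 a) (x1 a) (ybar a) (real x0 h0.1 a) (real x1 h1.1 a)
  exact ⟨fun s a => x a s, funext hx0, funext hx1, IsVarCSegment.pi hne hx⟩
end

section
/- Let (X × Y, c) and (X̲ × Y̲, c̲) be cost spaces with costs valued in EReal, and let P₁ : X → X̲ and P₂ : Y → Y̲ be surjective maps; write x ∼ x' when P₁(x) = P₁(x') and y ∼ y' when P₂(y) = P₂(y'). Assume P = (P₁,P₂) is a cost submersion, meaning: (1) for every (x,y) ∈ X × Y, c̲(P₁(x),P₂(y)) = inf{c(x',y') : x'∼x, y'∼y} = inf{c(x,y') : y'∼y} = inf{c(x',y) : x'∼x} (infima in EReal); (2) whenever c̲(P₁(x),P₂(y)) is a real number, each of these three infima is attained. Then: if (X × Y, c) is an NNCC space, so is (X̲ × Y̲, c̲). -/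
theorem EReal.coe_sub_le_coe_iff (a r : ℝ) (b : EReal) :
    (a : EReal) - b ≤ (r : EReal) ↔ ((a - r : ℝ) : EReal) ≤ b := by
  induction b with
  | bot => simp [-EReal.coe_sub]
  | top => simp
  | coe b =>
    rw [← EReal.coe_sub, EReal.coe_le_coe_iff, EReal.coe_le_coe_iff]
    constructor <;> intro h <;> linarith

/-- Cost submersions preserve the NNCC property. -/
theorem cost_submersion_preserves_NNCC
    {X Y Xu Yu : Type*}
    (c : X → Y → EReal) (cu : Xu → Yu → EReal)
    (P1 : X → Xu) (P2 : Y → Yu)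
    (hP1 : Function.Surjective P1) (hP2 : Function.Surjective P2)
    -- the projected cost is the fiberwise infimum, in three equivalent ways
    (hinf : ∀ x y, cu (P1 x) (P2 y)
        = ⨅ (x' : {x' : X // P1 x' = P1 x}) (y' : {y' : Y // P2 y' = P2 y}), c x'.1 y'.1)
    (hinfy : ∀ x y, cu (P1 x) (P2 y) = ⨅ (y' : {y' : Y // P2 y' = P2 y}), c x y'.1)
    (hinfx : ∀ x y, cu (P1 x) (P2 y) = ⨅ (x' : {x' : X // P1 x' = P1 x}), c x'.1 y)
    -- the infima are attained whenever the projected cost is finite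
    (hatt : ∀ x y, cu (P1 x) (P2 y) ≠ ⊤ → cu (P1 x) (P2 y) ≠ ⊥ →
      (∃ x' y', P1 x' = P1 x ∧ P2 y' = P2 y ∧ c x' y' = cu (P1 x) (P2 y)) ∧
      (∃ y', P2 y' = P2 y ∧ c x y' = cu (P1 x) (P2 y)) ∧
      (∃ x', P1 x' = P1 x ∧ c x' y = cu (P1 x) (P2 y)))
    (hnncc : IsNNCC c) :
    IsNNCC cu := by
  intro xu0 xu1 yu h0 h1
  obtain ⟨z0, rfl⟩ := hP1 xu0
  obtain ⟨z1, rfl⟩ := hP1 xu1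
  obtain ⟨ybar, rfl⟩ := hP2 yu
  obtain ⟨x0, hx0, hc0⟩ := (hatt z0 ybar h0.1 h0.2).2.2
  obtain ⟨x1, hx1, hc1⟩ := (hatt z1 ybar h1.1 h1.2).2.2
  rw [← hx0] at hc0 h0 ⊢
  rw [← hx1] at hc1 h1 ⊢
  rw [← hc0] at h0
  rw [← hc1] at h1
  obtain ⟨x, rfl, rfl, hfin, hseg⟩ := hnncc x0 x1 ybar h0 h1
  have cu_le (z : X) (y : Y) : cu (P1 z) (P2 y) ≤ c z y := by
    rw [hinfy]
    exact iInf_le (fun y' : {y' : Y // P2 y' = P2 y} => c z y'.1) ⟨y, rfl⟩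
  have le_cu {z : X} {y : Y} {a : EReal} (h : ∀ y', P2 y' = P2 y → a ≤ c z y') :
      a ≤ cu (P1 z) (P2 y) := by
    rw [hinfy]
    exact le_iInf fun y' => h y'.1 y'.2
  have sub_le_zero {z : X} (hz : c z ybar = cu (P1 z) (P2 ybar)) (y : Y)
      (hy : P2 y = P2 ybar) : c z ybar - c z y ≤ ((0 : ℝ) : EReal) := by
    rw [EReal.coe_zero]
    exact EReal.sub_nonpos.mpr (by rw [hz, ← hy]; exact cu_le z y)
  -- `ybar` remains optimal in its fibre along the lifted segment
  have optimal : ∀ s ∈ Set.Icc (0 : ℝ) 1, cu (P1 (x s)) (P2 ybar) = c (x s) ybar := by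
    intro s hs
    rcases hs.1.eq_or_lt with rfl | hs0
    · exact hc0.symm
    rcases hs.2.eq_or_lt with rfl | hs1
    · exact hc1.symm
    refine le_antisymm (cu_le _ _) (le_cu fun y hy => ?_)
    have h := hseg s ⟨hs0, hs1⟩ y 0 0 (sub_le_zero hc0 y hy) (sub_le_zero hc1 y hy)
    exact EReal.sub_nonpos.mp (by simpa using h)
  refine ⟨fun s => P1 (x s), rfl, rfl, fun s hs => ?_, ?_⟩
  · simpa only [optimal s hs] using hfin s hs
  · intro s hs yu t0 t1 ht0 ht1
    obtain ⟨y, rfl⟩ := hP2 yu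
    have hs' := Set.Ioo_subset_Icc_self hs
    simp only [optimal s hs', ← hc0, ← hc1] at ht0 ht1 ⊢
    have ha := EReal.coe_toReal (hfin s hs').1 (hfin s hs').2
    rw [← ha, EReal.coe_sub_le_coe_iff]
    refine le_cu fun y' hy' => ?_
    rw [← EReal.coe_sub_le_coe_iff, ha]
    rw [← hy'] at ht0 ht1
    exact hseg s hs y' t0 t1
      ((EReal.sub_le_sub le_rfl (cu_le _ _)).trans ht0)
      ((EReal.sub_le_sub le_rfl (cu_le _ _)).trans ht1)
end

section
/- Let X and Y be sets and c : X × Y → EReal. Given φ : Y → EReal and ȳ ∈ Y, define the c-subdifferential ∂ᶜφ(ȳ) as the set of x ∈ X such that φ(ȳ) and c(x,ȳ) are real numbers and, with the real number α := c(x,ȳ) − φ(ȳ), one has α + φ(y) ≤ c(x,y) in EReal for every y ∈ Y. Let x₀, x₁, x̃ ∈ X and ȳ ∈ Y be such that c(x₀,ȳ) and c(x₁,ȳ) are real. Then the following are equivalent: (i) c(x̃,ȳ) is real and for all y ∈ Y, c(x̃,ȳ) − c(x̃,y) ≤ max{c(x₀,ȳ) − c(x₀,y), c(x₁,ȳ)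 − c(x₁,y)} (EReal subtraction; all minuends are real); (ii) for every function φ : Y → EReal, if x₀ ∈ ∂ᶜφ(ȳ) and x₁ ∈ ∂ᶜφ(ȳ) then x̃ ∈ ∂ᶜφ(ȳ). -/
/-- `x` belongs to the c-subdifferential `∂ᶜφ(ȳ)`: `φ ȳ` and `c x ȳ` are real and, with
`α := c x ȳ - φ ȳ ∈ ℝ`, one has `α + φ y ≤ c x y` in `EReal` for every `y`. -/
def MemCSubdiff {X Y : Type*} (c : X → Y → EReal) (φ : Y → EReal) (ybar : Y)
    (x : X) : Prop :=
  φ ybar ≠ ⊤ ∧ φ ybar ≠ ⊥ ∧ c x ybar ≠ ⊤ ∧ c x ybar ≠ ⊥ ∧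
  ∀ y : Y, (((c x ybar).toReal - (φ ybar).toReal : ℝ) : EReal) + φ y ≤ c x y

/-- Moving terms across an inequality in `EReal` when the constants are real. -/
theorem EReal.coe_sub_add_le_iff (a f : ℝ) (p q : EReal) :
    ((a - f : ℝ) : EReal) + p ≤ q ↔ (a : EReal) - q ≤ (f : EReal) - p := by
  induction p with
  | bot => simp
  | top =>
    induction q with
    | bot => simp [-EReal.coe_sub]
    | top => simp
    | coe q => simp [← EReal.coe_sub]
  | coe p =>
    induction q with
    | bot => simp [← EReal.coe_sub, ← EReal.coe_add]
    | top => simp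
    | coe q =>
      norm_cast
      constructor <;> intro h <;> linarith

theorem memCSubdiff_iff {X Y : Type*} {c : X → Y → EReal} {φ : Y → EReal} {ybar : Y} {x : X} :
    MemCSubdiff c φ ybar x ↔ (φ ybar ≠ ⊤ ∧ φ ybar ≠ ⊥) ∧ (c x ybar ≠ ⊤ ∧ c x ybar ≠ ⊥) ∧
      ∀ y, c x ybar - c x y ≤ φ ybar - φ y := by
  simp only [MemCSubdiff, and_assoc]
  refine and_congr_right fun hf => and_congr_right fun hf' => and_congr_right fun hc =>
    and_congr_right fun hc' => forall_congr' fun y => ?_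
  rw [EReal.coe_sub_add_le_iff, EReal.coe_toReal hc hc', EReal.coe_toReal hf hf']

/-- Loeper-type characterization: the "below the max" inequality at `x̃`
is equivalent to stability of c-subdifferentials at `ȳ` under adding `x̃`. -/
theorem below_max_iff_csubdiff
    {X Y : Type*} (c : X → Y → EReal)
    (x0 x1 xt : X) (ybar : Y)
    (h0 : c x0 ybar ≠ ⊤ ∧ c x0 ybar ≠ ⊥)
    (h1 : c x1 ybar ≠ ⊤ ∧ c x1 ybar ≠ ⊥) :
    ((c xt ybar ≠ ⊤ ∧ c xt ybar ≠ ⊥) ∧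
      ∀ y : Y, c xt ybar - c xt y ≤
        max (c x0 ybar - c x0 y) (c x1 ybar - c x1 y))
    ↔ (∀ φ : Y → EReal,
        MemCSubdiff c φ ybar x0 → MemCSubdiff c φ ybar x1 → MemCSubdiff c φ ybar xt) := by
  simp only [memCSubdiff_iff]
  constructor
  · rintro ⟨ht, h⟩ φ ⟨hφ, -, hx0⟩ ⟨-, -, hx1⟩
    exact ⟨hφ, ht, fun y => (h y).trans (max_le (hx0 y) (hx1 y))⟩
  · intro h
    let m : Y → EReal := fun y => max (c x0 ybar - c x0 y) (c x1 ybar - c x1 y)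
    have hm : m ybar = 0 := by
      simp only [m, EReal.sub_self h0.1 h0.2, EReal.sub_self h1.1 h1.2, max_self]
    have hsub : ∀ y, -m ybar - -m y = m y := by
      intro y
      rw [hm, neg_zero, zero_sub, neg_neg]
    have key := h (fun y => -m y)
    simp only [hsub] at key
    have hfin : -m ybar ≠ ⊤ ∧ -m ybar ≠ ⊥ := by simp [hm]
    exact (key ⟨hfin, h0, fun y => le_max_left _ _⟩ ⟨hfin, h1, fun y => le_max_right _ _⟩).2
end

section
/- Let X, Y, Γ be Polish spaces with their Borel σ-algebras, let μ, σ, γ be Borel probability measures on X, Y, Γ respectively, and let π be a Borel probability measure on X × Y whose first marginal is μ and whose second marginal is σ. Let Λ : Γ → X be a Borel measurable map with Λ_#γ = μ. Then there exists a Borel probability measure γ̃ on Γ × Y whose first marginal is γ and whose second marginal is σ, and such that the pushforward of γ̃ under the map (w,y) ↦ (Λ(w), y) equals π. -/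
open MeasureTheory

open scoped ProbabilityTheory

/-- Pushing the first coordinate of `γ ⊗ₘ κ.comap f hf` forward along `f` gives
`γ.map f ⊗ₘ κ`. -/
lemma map_prodMap_compProd_comap {W X Y : Type*} [MeasurableSpace W] [MeasurableSpace X]
    [MeasurableSpace Y] (γ : Measure W) [SFinite γ] (κ : ProbabilityTheory.Kernel X Y)
    [ProbabilityTheory.IsSFiniteKernel κ] {f : W → X} (hf : Measurable f) :
    (γ ⊗ₘ κ.comap f hf).map (Prod.map f id) = γ.map f ⊗ₘ κ := by
  ext s hs
  have hfid : Measurable (Prod.map f (id : Y → Y)) := hf.prodMap measurable_id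
  rw [Measure.map_apply hfid hs, Measure.compProd_apply (hfid hs), Measure.compProd_apply hs,
    lintegral_map (ProbabilityTheory.Kernel.measurable_kernel_prodMk_left hs) hf]
  rfl

/-- Coupling extension: if `μ = Λ_# γ` and `π` is a coupling of
`(μ, σ)`, then there is a coupling `γ̃` of `(γ, σ)` pushing forward to `π` under
`(w, y) ↦ (Λ w, y)`. -/
theorem coupling_extension
    {X Y Γ : Type*}
    [MeasurableSpace X] [TopologicalSpace X] [PolishSpace X] [BorelSpace X]
    [MeasurableSpace Y] [TopologicalSpace Y] [PolishSpace Y] [BorelSpace Y]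
    [MeasurableSpace Γ] [TopologicalSpace Γ] [PolishSpace Γ] [BorelSpace Γ]
    (μ : Measure X) (σ : Measure Y) (γ : Measure Γ)
    [IsProbabilityMeasure μ] [IsProbabilityMeasure σ] [IsProbabilityMeasure γ]
    (π : Measure (X × Y)) [IsProbabilityMeasure π]
    (hπ1 : π.map Prod.fst = μ) (hπ2 : π.map Prod.snd = σ)
    (Λ : Γ → X) (hΛ : Measurable Λ) (hpush : γ.map Λ = μ) :
    ∃ γt : Measure (Γ × Y), IsProbabilityMeasure γt ∧
      γt.map Prod.fst = γ ∧ γt.map Prod.snd = σ ∧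
      γt.map (fun p => (Λ p.1, p.2)) = π := by
  subst hπ1 hπ2
  have : Nonempty Y := (nonempty_of_isProbabilityMeasure π).map Prod.snd
  have hmap : (γ ⊗ₘ π.condKernel.comap Λ hΛ).map (Prod.map Λ id) = π := by
    rw [map_prodMap_compProd_comap, hpush]
    exact π.disintegrate π.condKernel
  refine ⟨γ ⊗ₘ π.condKernel.comap Λ hΛ, inferInstance, Measure.fst_compProd _ _, ?_, hmap⟩
  refine Eq.trans ?_ (congrArg (Measure.map Prod.snd) hmap)
  rw [Measure.map_map measurable_snd (by fun_prop)]
  rfl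
end

section
/- Let X be a measurable space, let μ₀, μ₁, ν be probability measures on X with KL(μ₀,ν) < ∞ and KL(μ₁,ν) < ∞, let s ∈ (0,1) and set μ(s) = (1−s)·μ₀ + s·μ₁. Then KL(μ(s),ν) < ∞ and (1−s)·KL(μ₀,ν) + s·KL(μ₁,ν) = KL(μ(s),ν) + (1−s)·KL(μ₀,μ(s)) + s·KL(μ₁,μ(s)). -/
open MeasureTheory
open scoped ENNReal

open Classical in
/-- The Kullback--Leibler divergence `KL(μ, ν) = ∫ log (dμ/dν) dμ` when `μ ≪ ν` and the
log-likelihood ratio is `μ`-integrable, and `+∞` otherwise. -/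
noncomputable def KL {X : Type*} [MeasurableSpace X] (μ ν : Measure X) : ℝ≥0∞ :=
  if μ ≪ ν ∧ Integrable (fun x => Real.log ((μ.rnDeriv ν x).toReal)) μ
  then ENNReal.ofReal (∫ x, Real.log ((μ.rnDeriv ν x).toReal) ∂μ)
  else ⊤

lemma KL_eq_klDiv {X : Type*} [MeasurableSpace X] (μ ν : Measure X)
    [IsProbabilityMeasure μ] [IsProbabilityMeasure ν] :
    KL μ ν = InformationTheory.klDiv μ ν := by
  rw [KL, InformationTheory.klDiv_def]
  simp only [llr_def, probReal_univ, add_sub_cancel_right]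
  congr

/-- The log-likelihood ratio is integrable as soon as the density is bounded. -/
lemma integrable_llr_of_le_smul {X : Type*} [MeasurableSpace X] {μ π : Measure X}
    [IsFiniteMeasure μ] [IsFiniteMeasure π] {C : ℝ≥0∞} (hC : C ≠ ∞) (h : μ ≤ C • π) :
    Integrable (llr μ π) μ := by
  have hac : μ ≪ π := Measure.absolutelyContinuous_of_le_smul h
  rw [← integrable_rnDeriv_mul_log_iff hac]
  have hle : μ.rnDeriv π ≤ᵐ[π] fun _ => C := by
    refine ae_le_of_forall_setLIntegral_le_of_sigmaFinite (μ.measurable_rnDeriv π) fun s _ _ => ?_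
    rw [setLIntegral_const]
    exact (Measure.setLIntegral_rnDeriv_le s).trans (h s)
  obtain ⟨B, hB⟩ := (isCompact_Icc (a := (0 : ℝ)) (b := C.toReal)).exists_bound_of_continuousOn
    Real.continuous_mul_log.continuousOn
  refine Integrable.of_bound (Real.continuous_mul_log.measurable.comp
    (μ.measurable_rnDeriv π).ennreal_toReal).aestronglyMeasurable B ?_
  filter_upwards [hle] with x hx
  exact hB _ ⟨ENNReal.toReal_nonneg, ENNReal.toReal_mono hC hx⟩

lemma llr_add_llr {X : Type*} [MeasurableSpace X] {μ π ν : Measure X}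
    [SigmaFinite μ] [SigmaFinite π] [SigmaFinite ν] (hμπ : μ ≪ π) (hπν : π ≪ ν) :
    llr μ π + llr π ν =ᵐ[μ] llr μ ν := by
  filter_upwards [(hμπ.trans hπν).ae_le (Measure.rnDeriv_mul_rnDeriv (κ := ν) hμπ),
    Measure.rnDeriv_pos hμπ, hμπ.ae_le (Measure.rnDeriv_ne_top μ π),
    hμπ.ae_le (Measure.rnDeriv_pos hπν), (hμπ.trans hπν).ae_le (Measure.rnDeriv_ne_top π ν)]
    with x hx h1 h1' h2 h2'
  simp only [Pi.add_apply, Pi.mul_apply, llr] at hx ⊢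
  rw [← hx, ENNReal.toReal_mul, Real.log_mul (ENNReal.toReal_pos h1.ne' h1').ne'
    (ENNReal.toReal_pos h2.ne' h2').ne']

lemma klDiv_eq_ofReal_integral_llr {X : Type*} [MeasurableSpace X] {μ ν : Measure X}
    [IsProbabilityMeasure μ] [IsProbabilityMeasure ν] (h : μ ≪ ν) (hi : Integrable (llr μ ν) μ) :
    0 ≤ ∫ x, llr μ ν x ∂μ ∧
      InformationTheory.klDiv μ ν = ENNReal.ofReal (∫ x, llr μ ν x ∂μ) := by
  have h0 := InformationTheory.integral_llr_add_sub_measure_univ_nonneg h hi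
  have h1 := InformationTheory.klDiv_of_ac_of_integrable h hi
  simp only [probReal_univ, add_sub_cancel_right] at h0 h1
  exact ⟨h0, h1⟩

/-- The additive KL identity along linear interpolation:
`(1-s)·KL(μ₀,ν) + s·KL(μ₁,ν) = KL(μ(s),ν) + (1-s)·KL(μ₀,μ(s)) + s·KL(μ₁,μ(s))`, where
`μ(s) = (1-s)·μ₀ + s·μ₁`; moreover `KL(μ(s),ν) < ∞`. -/
theorem KL_interpolation_identity {X : Type*} [MeasurableSpace X]
    (μ0 μ1 ν : Measure X)
    [IsProbabilityMeasure μ0] [IsProbabilityMeasure μ1] [IsProbabilityMeasure ν]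
    (h0 : KL μ0 ν ≠ ⊤) (h1 : KL μ1 ν ≠ ⊤)
    (s : ℝ) (hs : s ∈ Set.Ioo (0:ℝ) 1) :
    KL (ENNReal.ofReal (1 - s) • μ0 + ENNReal.ofReal s • μ1) ν ≠ ⊤ ∧
    ENNReal.ofReal (1 - s) * KL μ0 ν + ENNReal.ofReal s * KL μ1 ν =
      KL (ENNReal.ofReal (1 - s) • μ0 + ENNReal.ofReal s • μ1) ν
      + ENNReal.ofReal (1 - s) *
          KL μ0 (ENNReal.ofReal (1 - s) • μ0 + ENNReal.ofReal s • μ1)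
      + ENNReal.ofReal s *
          KL μ1 (ENNReal.ofReal (1 - s) • μ0 + ENNReal.ofReal s • μ1) := by
  obtain ⟨hs0, hs1⟩ := hs
  have ha : 0 < 1 - s := sub_pos.2 hs1
  set a := ENNReal.ofReal (1 - s) with ha_def
  set b := ENNReal.ofReal s with hb_def
  have ha0 : a ≠ 0 := by simpa [ha_def] using hs1
  have hb0 : b ≠ 0 := by simpa [hb_def] using hs0
  have hat : a ≠ ∞ := ENNReal.ofReal_ne_top
  have hbt : b ≠ ∞ := ENNReal.ofReal_ne_top
  have hab : a + b = 1 := by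
    rw [ha_def, hb_def, ← ENNReal.ofReal_add ha.le hs0.le, sub_add_cancel, ENNReal.ofReal_one]
  have har : a.toReal = 1 - s := ENNReal.toReal_ofReal ha.le
  have hbr : b.toReal = s := ENNReal.toReal_ofReal hs0.le
  set π := a • μ0 + b • μ1 with hπ
  have : IsProbabilityMeasure π := ⟨by simp [hπ, hab]⟩
  simp only [KL_eq_klDiv] at h0 h1 ⊢
  obtain ⟨hac0, hi0⟩ := InformationTheory.klDiv_ne_top_iff.1 h0
  obtain ⟨hac1, hi1⟩ := InformationTheory.klDiv_ne_top_iff.1 h1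
  have hle0 : μ0 ≤ a⁻¹ • π := by
    rw [hπ, smul_add, smul_smul, ENNReal.inv_mul_cancel ha0 hat, one_smul]
    exact Measure.le_add_right le_rfl
  have hle1 : μ1 ≤ b⁻¹ • π := by
    rw [hπ, smul_add, smul_smul b⁻¹ b, ENNReal.inv_mul_cancel hb0 hbt, one_smul]
    exact Measure.le_add_left le_rfl
  have hac0π : μ0 ≪ π := Measure.absolutelyContinuous_of_le_smul hle0
  have hac1π : μ1 ≪ π := Measure.absolutelyContinuous_of_le_smul hle1
  have hacπ : π ≪ ν := (hac0.smul_left a).add_left (hac1.smul_left b)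
  have hi0π := integrable_llr_of_le_smul (ENNReal.inv_ne_top.2 ha0) hle0
  have hi1π := integrable_llr_of_le_smul (ENNReal.inv_ne_top.2 hb0) hle1
  have hadd0 := llr_add_llr hac0π hacπ
  have hadd1 := llr_add_llr hac1π hacπ
  have hiπ0 : Integrable (llr π ν) μ0 :=
    (integrable_add_iff_integrable_right hi0π).1 (hi0.congr hadd0.symm)
  have hiπ1 : Integrable (llr π ν) μ1 :=
    (integrable_add_iff_integrable_right hi1π).1 (hi1.congr hadd1.symm)
  have hiπ : Integrable (llr π ν) π := (hiπ0.smul_measure hat).add_measure (hiπ1.smul_measure hbt)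
  have hint0 := integral_congr_ae hadd0
  have hint1 := integral_congr_ae hadd1
  rw [integral_add' hi0π hiπ0] at hint0
  rw [integral_add' hi1π hiπ1] at hint1
  have hintπ : ∫ x, llr π ν x ∂π = (1 - s) * ∫ x, llr π ν x ∂μ0 + s * ∫ x, llr π ν x ∂μ1 := by
    conv_lhs => rw [hπ]
    rw [integral_add_measure (hiπ0.smul_measure hat) (hiπ1.smul_measure hbt),
      integral_smul_measure, integral_smul_measure, har, hbr, smul_eq_mul, smul_eq_mul]
  obtain ⟨hnn0, hkl0⟩ := klDiv_eq_ofReal_integral_llr hac0 hi0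
  obtain ⟨hnn1, hkl1⟩ := klDiv_eq_ofReal_integral_llr hac1 hi1
  obtain ⟨hnn0π, hkl0π⟩ := klDiv_eq_ofReal_integral_llr hac0π hi0π
  obtain ⟨hnn1π, hkl1π⟩ := klDiv_eq_ofReal_integral_llr hac1π hi1π
  obtain ⟨hnnπ, hklπ⟩ := klDiv_eq_ofReal_integral_llr hacπ hiπ
  refine ⟨InformationTheory.klDiv_ne_top hacπ hiπ, ?_⟩
  rw [hkl0, hkl1, hkl0π, hkl1π, hklπ, ha_def, hb_def]
  simp only [← ENNReal.ofReal_mul ha.le, ← ENNReal.ofReal_mul hs0.le]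
  rw [← ENNReal.ofReal_add (by positivity) (by positivity),
    ← ENNReal.ofReal_add (by positivity) (by positivity),
    ← ENNReal.ofReal_add (by positivity) (by positivity)]
  congr 1
  rw [hintπ, ← hint0, ← hint1]
  ring
end
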